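/- arXiv:2006.02310 — 2 statements merged into one kernel-verified Lean document; each statement's English description precedes it below -/
import Mathlib

section
/- Let X, Y1, ..., Ym be independent finitely supported real-valued random variables with H(X) > 0, and suppose that for each i, H(X + Yi) ≤ H(X)(1 + Cε) for some constants C > 0 and ε ∈ (0, 1/2). Then H(X + Y1 + ... + Ym) ≤ H(X)(1 + mCε). -/
open scoped Classical BigOperators

/-- Probability of the event `X = a` under the probability mass function `μ`. -/
noncomputable def pr {Ω α : Type*} [Fintype Ω] (μ : Ω → ℝ) (X : Ω → α) (a : α) : ℝ :=
  ∑ ω : Ω, if X ω = a then μ ω else 0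

/-- Shannon entropy of the discrete random variable `X` on the finite probability
space with mass function `μ`. -/
noncomputable def entropy {Ω α : Type*} [Fintype Ω] (μ : Ω → ℝ) (X : Ω → α) : ℝ :=
  ∑ a ∈ Finset.univ.image X, Real.negMulLog (pr μ X a)

lemma ex_comp {Ω α : Type*} [Fintype Ω] (μ : Ω → ℝ) (X : Ω → α) (T : Finset α)
    (hT : ∀ ω, X ω ∈ T) (f : α → ℝ) :
    ∑ ω, μ ω * f (X ω) = ∑ a ∈ T, pr μ X a * f a := by
  unfold pr
  simp_rw [Finset.sum_mul]
  rw [Finset.sum_comm]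
  refine Finset.sum_congr rfl fun ω _ => ?_
  rw [Finset.sum_eq_single (X ω)]
  · simp
  · intro b _ hb
    simp [Ne.symm hb]
  · intro h
    exact absurd (hT ω) h

lemma pr_eq_ex {Ω α : Type*} [Fintype Ω] (μ : Ω → ℝ) (X : Ω → α) (a : α) :
    pr μ X a = ∑ ω, μ ω * (if X ω = a then 1 else 0) := by
  unfold pr
  refine Finset.sum_congr rfl fun ω _ => ?_
  split_ifs <;> simp

lemma pr_nonneg' {Ω α : Type*} [Fintype Ω] (μ : Ω → ℝ) (hμ0 : ∀ ω, 0 ≤ μ ω)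
    (X : Ω → α) (a : α) : 0 ≤ pr μ X a := by
  unfold pr
  refine Finset.sum_nonneg fun ω _ => ?_
  split_ifs
  · exact hμ0 ω
  · exact le_rfl

lemma pr_pos' {Ω α : Type*} [Fintype Ω] (μ : Ω → ℝ) (hμ0 : ∀ ω, 0 ≤ μ ω)
    (X : Ω → α) (ω : Ω) (h : 0 < μ ω) : 0 < pr μ X (X ω) := by
  unfold pr
  refine Finset.sum_pos' (fun ω _ => ?_) ⟨ω, Finset.mem_univ _, by simpa using h⟩
  split_ifs
  · exact hμ0 _
  · exact le_rfl

lemma entropy_eq_ex {Ω α : Type*} [Fintype Ω] (μ : Ω → ℝ) (X : Ω → α) :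
    entropy μ X = -∑ ω, μ ω * Real.log (pr μ X (X ω)) := by
  rw [ex_comp μ X (Finset.univ.image X) (by simp) (fun a => Real.log (pr μ X a))]
  unfold entropy Real.negMulLog
  rw [← Finset.sum_neg_distrib]
  exact Finset.sum_congr rfl fun a _ => by ring

lemma sum_pr {Ω α : Type*} [Fintype Ω] (μ : Ω → ℝ) (hμ1 : ∑ ω, μ ω = 1) (X : Ω → α)
    (T : Finset α) (hT : ∀ ω, X ω ∈ T) : ∑ a ∈ T, pr μ X a = 1 := by
  have := ex_comp μ X T hT (fun _ => 1)
  simp only [mul_one] at this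
  rw [← this, hμ1]

/-- Expectation of a function of three independent variables. -/
lemma ex_triple {Ω : Type*} [Fintype Ω] (μ : Ω → ℝ) (X Y Z : Ω → ℝ)
    (hind : ∀ x y z, pr μ (fun ω => (X ω, Y ω, Z ω)) (x, y, z) = pr μ X x * pr μ Y y * pr μ Z z)
    (A B D : Finset ℝ) (hA : ∀ ω, X ω ∈ A) (hB : ∀ ω, Y ω ∈ B) (hD : ∀ ω, Z ω ∈ D)
    (F : ℝ → ℝ → ℝ → ℝ) :
    ∑ ω, μ ω * F (X ω) (Y ω) (Z ω) =
      ∑ x ∈ A, ∑ y ∈ B, ∑ z ∈ D, pr μ X x * pr μ Y y * pr μ Z z * F x y z := by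
  have := ex_comp μ (fun ω => (X ω, Y ω, Z ω)) (A ×ˢ B ×ˢ D)
    (fun ω => by simp [hA, hB, hD]) (fun p => F p.1 p.2.1 p.2.2)
  simp only at this
  rw [this, Finset.sum_product]
  refine Finset.sum_congr rfl fun x _ => ?_
  rw [Finset.sum_product]
  simp_rw [hind]

lemma ratio_le {Ω : Type*} [Fintype Ω] (μ : Ω → ℝ)
    (hμ0 : ∀ ω, 0 ≤ μ ω) (hμ1 : ∑ ω, μ ω = 1) (X Y Z : Ω → ℝ)
    (hind : ∀ x y z, pr μ (fun ω => (X ω, Y ω, Z ω)) (x, y, z)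
      = pr μ X x * pr μ Y y * pr μ Z z) :
    ∑ ω, μ ω * (pr μ (fun ω => X ω + Y ω) (X ω + Y ω) * pr μ (fun ω => X ω + Z ω) (X ω + Z ω)
      / (pr μ X (X ω) * pr μ (fun ω => X ω + Y ω + Z ω) (X ω + Y ω + Z ω))) ≤ 1 := by
  obtain ⟨A, hA⟩ : ∃ A : Finset ℝ, ∀ ω, X ω ∈ A := ⟨Finset.univ.image X, by simp⟩
  obtain ⟨B, hB⟩ : ∃ A : Finset ℝ, ∀ ω, Y ω ∈ A := ⟨Finset.univ.image Y, by simp⟩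
  obtain ⟨D, hD⟩ : ∃ A : Finset ℝ, ∀ ω, Z ω ∈ A := ⟨Finset.univ.image Z, by simp⟩
  obtain ⟨T, hT⟩ : ∃ T : Finset ℝ, ∀ x ∈ A, ∀ y ∈ B, ∀ z ∈ D, x + y + z ∈ T :=
    ⟨(A ×ˢ B ×ˢ D).image (fun p => p.1 + p.2.1 + p.2.2), fun x hx y hy z hz =>
      Finset.mem_image.2 ⟨(x, y, z), by simp [hx, hy, hz], rfl⟩⟩
  set P := pr μ (fun ω => X ω + Y ω) with hP
  set Q := pr μ (fun ω => X ω + Z ω) with hQ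
  set S := pr μ (fun ω => X ω + Y ω + Z ω) with hS
  set p := pr μ X with hp
  set q := pr μ Y with hq
  set r := pr μ Z with hr
  have hp0 : ∀ x, 0 ≤ p x := pr_nonneg' μ hμ0 _
  have hq0 : ∀ x, 0 ≤ q x := pr_nonneg' μ hμ0 _
  have hr0 : ∀ x, 0 ≤ r x := pr_nonneg' μ hμ0 _
  have hP0 : ∀ x, 0 ≤ P x := pr_nonneg' μ hμ0 _
  have hQ0 : ∀ x, 0 ≤ Q x := pr_nonneg' μ hμ0 _
  have hS0 : ∀ x, 0 ≤ S x := pr_nonneg' μ hμ0 _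
  have E := ex_triple μ X Y Z hind A B D hA hB hD
  have hPe : ∀ t, P t = ∑ x ∈ A, ∑ y ∈ B, p x * q y * (if x + y = t then 1 else 0) := by
    intro t
    rw [hP, pr_eq_ex, E (fun x y z => if x + y = t then 1 else 0)]
    refine Finset.sum_congr rfl fun x _ => Finset.sum_congr rfl fun y _ => ?_
    rw [← Finset.sum_mul, ← Finset.mul_sum, sum_pr μ hμ1 Z D hD, mul_one]
  have hQe : ∀ t, Q t = ∑ x ∈ A, ∑ z ∈ D, p x * r z * (if x + z = t then 1 else 0) := by
    intro t
    rw [hQ, pr_eq_ex, E (fun x y z => if x + z = t then 1 else 0)]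
    refine Finset.sum_congr rfl fun x _ => ?_
    rw [Finset.sum_comm]
    refine Finset.sum_congr rfl fun z _ => ?_
    rw [← Finset.sum_mul, ← Finset.sum_mul, ← Finset.mul_sum, sum_pr μ hμ1 Y B hB, mul_one]
  have hSP : ∀ s, S s = ∑ z ∈ D, r z * P (s - z) := by
    intro s
    rw [hS, pr_eq_ex, E (fun x y z => if x + y + z = s then 1 else 0)]
    simp_rw [hPe, Finset.mul_sum]
    rw [Finset.sum_congr rfl fun x _ => Finset.sum_comm, Finset.sum_comm]
    refine Finset.sum_congr rfl fun z _ => Finset.sum_congr rfl fun x _ =>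
      Finset.sum_congr rfl fun y _ => ?_
    have : (x + y + z = s) ↔ (x + y = s - z) := by constructor <;> intro h <;> linarith
    simp only [this]
    ring
  have hSQ : ∀ s, S s = ∑ y ∈ B, q y * Q (s - y) := by
    intro s
    rw [hS, pr_eq_ex, E (fun x y z => if x + y + z = s then 1 else 0)]
    simp_rw [hQe, Finset.mul_sum]
    rw [Finset.sum_comm]
    refine Finset.sum_congr rfl fun y _ => Finset.sum_congr rfl fun x _ =>
      Finset.sum_congr rfl fun z _ => ?_
    have : (x + y + z = s) ↔ (x + z = s - y) := by constructor <;> intro h <;> linarith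
    simp only [this]
    ring
  rw [E (fun x y z => P (x + y) * Q (x + z) / (p x * S (x + y + z)))]
  calc _ ≤ ∑ x ∈ A, ∑ y ∈ B, ∑ z ∈ D, q y * r z * (P (x + y + z - z) * Q (x + y + z - y) / S (x + y + z)) := by
        refine Finset.sum_le_sum fun x _ => Finset.sum_le_sum fun y _ =>
          Finset.sum_le_sum fun z _ => ?_
        have e1 : x + y + z - z = x + y := by ring
        have e2 : x + y + z - y = x + z := by ring
        rw [e1, e2]
        rcases (hp0 x).eq_or_lt with h | h
        · rw [show pr μ X x = 0 from h.symm]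
          have := hq0 y; have := hr0 z; have := hP0 (x + y); have := hQ0 (x + z)
          have := hS0 (x + y + z)
          simp only [zero_mul]
          positivity
        · apply le_of_eq
          have h' := h.ne'
          change p x * q y * r z * _ = _
          rw [mul_comm (p x) (S _), ← div_div]
          field_simp
    _ = ∑ y ∈ B, ∑ z ∈ D, ∑ x ∈ A, q y * r z * (P (x + y + z - z) * Q (x + y + z - y) / S (x + y + z)) := by
        rw [Finset.sum_comm]
        refine Finset.sum_congr rfl fun y _ => ?_
        rw [Finset.sum_comm]
    _ ≤ ∑ y ∈ B, ∑ z ∈ D, ∑ s ∈ T, q y * r z * (P (s - z) * Q (s - y) / S s) := by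
        refine Finset.sum_le_sum fun y hy => Finset.sum_le_sum fun z hz => ?_
        have hinj : Function.Injective (fun x : ℝ => x + y + z) := fun a b h => by
          simpa using h
        refine (Finset.sum_map A ⟨_, hinj⟩
          (fun s => q y * r z * (P (s - z) * Q (s - y) / S s))).symm.trans_le ?_
        refine Finset.sum_le_sum_of_subset_of_nonneg ?_ ?_
        · intro s hs
          obtain ⟨x, hx, rfl⟩ := Finset.mem_map.1 hs
          exact hT x hx y hy z hz
        · intro s _ _
          have := hq0 y; have := hr0 z; have := hP0 (s - z); have := hQ0 (s - y)
          have := hS0 s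
          positivity
    _ = ∑ s ∈ T, (∑ y ∈ B, q y * Q (s - y)) * (∑ z ∈ D, r z * P (s - z)) / S s := by
        simp_rw [Finset.sum_mul_sum, Finset.sum_div]
        symm
        rw [Finset.sum_comm]
        refine Finset.sum_congr rfl fun y _ => ?_
        rw [Finset.sum_comm]
        refine Finset.sum_congr rfl fun z _ => Finset.sum_congr rfl fun s _ => ?_
        ring
    _ = ∑ s ∈ T, S s := by
        refine Finset.sum_congr rfl fun s _ => ?_
        rw [← hSP, ← hSQ, mul_self_div_self]
    _ ≤ 1 := le_of_eq (sum_pr μ hμ1 _ T fun ω => hT _ (hA ω) _ (hB ω) _ (hD ω))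

lemma entropy_submod {Ω : Type*} [Fintype Ω] (μ : Ω → ℝ)
    (hμ0 : ∀ ω, 0 ≤ μ ω) (hμ1 : ∑ ω, μ ω = 1) (X Y Z : Ω → ℝ)
    (hind : ∀ x y z, pr μ (fun ω => (X ω, Y ω, Z ω)) (x, y, z)
      = pr μ X x * pr μ Y y * pr μ Z z) :
    entropy μ (fun ω => X ω + Y ω + Z ω) + entropy μ X ≤
      entropy μ (fun ω => X ω + Y ω) + entropy μ (fun ω => X ω + Z ω) := by
  have hR := ratio_le μ hμ0 hμ1 X Y Z hind
  rw [entropy_eq_ex, entropy_eq_ex, entropy_eq_ex, entropy_eq_ex]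
  have key : ∀ ω, μ ω * Real.log (pr μ (fun ω => X ω + Y ω) (X ω + Y ω))
      + μ ω * Real.log (pr μ (fun ω => X ω + Z ω) (X ω + Z ω))
      - μ ω * Real.log (pr μ X (X ω))
      - μ ω * Real.log (pr μ (fun ω => X ω + Y ω + Z ω) (X ω + Y ω + Z ω)) ≤
      μ ω * (pr μ (fun ω => X ω + Y ω) (X ω + Y ω) * pr μ (fun ω => X ω + Z ω) (X ω + Z ω)
      / (pr μ X (X ω) * pr μ (fun ω => X ω + Y ω + Z ω) (X ω + Y ω + Z ω))) - μ ω := by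
    intro ω
    rcases (hμ0 ω).eq_or_lt with h | h
    · simp [← h]
    · have h1 := pr_pos' μ hμ0 X ω h
      have h2 := pr_pos' μ hμ0 (fun ω => X ω + Y ω) ω h
      have h3 := pr_pos' μ hμ0 (fun ω => X ω + Z ω) ω h
      have h4 := pr_pos' μ hμ0 (fun ω => X ω + Y ω + Z ω) ω h
      have := Real.log_le_sub_one_of_pos (div_pos (mul_pos h2 h3) (mul_pos h1 h4))
      rw [Real.log_div (mul_pos h2 h3).ne' (mul_pos h1 h4).ne', Real.log_mul h2.ne' h3.ne',
        Real.log_mul h1.ne' h4.ne'] at this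
      have := mul_le_mul_of_nonneg_left this h.le
      linarith
  have := Finset.sum_le_sum (s := Finset.univ) fun ω _ => key ω
  simp only [Finset.sum_add_distrib, Finset.sum_sub_distrib] at this
  linarith

lemma ex_prod {Ω : Type*} [Fintype Ω] (μ : Ω → ℝ)
    (m : ℕ) (X : Ω → ℝ) (Y : Fin m → Ω → ℝ)
    (hindep : ∀ (x : ℝ) (v : Fin m → ℝ),
      pr μ (fun ω => (X ω, fun i => Y i ω)) (x, v) = pr μ X x * ∏ i, pr μ (Y i) (v i))
    (f : ℝ → ℝ) (g : Fin m → ℝ → ℝ) :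
    ∑ ω, μ ω * (f (X ω) * ∏ i, g i (Y i ω)) =
      (∑ ω, μ ω * f (X ω)) * ∏ i, ∑ ω, μ ω * g i (Y i ω) := by
  obtain ⟨A, hA⟩ : ∃ A : Finset ℝ, ∀ ω, X ω ∈ A := ⟨Finset.univ.image X, by simp⟩
  have hB' : ∀ i, ∃ A : Finset ℝ, ∀ ω, Y i ω ∈ A := fun i => ⟨Finset.univ.image (Y i), by simp⟩
  choose B hB using hB'
  have := ex_comp μ (fun ω => (X ω, fun i => Y i ω)) (A ×ˢ Fintype.piFinset B)
    (fun ω => by simp [hA, hB]) (fun p => f p.1 * ∏ i, g i (p.2 i))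
  simp only at this
  rw [this, ex_comp μ X A hA f, Finset.prod_congr rfl fun i _ => ex_comp μ (Y i) (B i) (hB i) (g i),
    Finset.prod_univ_sum, Finset.sum_product, Finset.sum_mul_sum]
  refine Finset.sum_congr rfl fun x _ => Finset.sum_congr rfl fun v _ => ?_
  rw [hindep, Finset.prod_mul_distrib]
  ring

lemma ex_split {Ω : Type*} [Fintype Ω] (μ : Ω → ℝ) (U V : Ω → ℝ) (B : Finset ℝ)
    (hB : ∀ ω, V ω ∈ B) (h : ℝ → ℝ) (G : Ω → ℝ) :
    ∑ ω, μ ω * (h (V ω + U ω) * G ω) =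
      ∑ y ∈ B, ∑ ω, μ ω * (h (y + U ω) * ((if V ω = y then 1 else 0) * G ω)) := by
  rw [Finset.sum_comm]
  refine Finset.sum_congr rfl fun ω _ => ?_
  rw [Finset.sum_eq_single (V ω)]
  · simp
  · intro b _ hb
    simp [Ne.symm hb]
  · intro h
    exact absurd (hB ω) h

/-- Grouping a block of independent variables into their sum. -/
lemma ex_block {Ω : Type*} [Fintype Ω] (μ : Ω → ℝ) (hμ1 : ∑ ω, μ ω = 1)
    (m : ℕ) (X : Ω → ℝ) (Y : Fin m → Ω → ℝ)
    (hindep : ∀ (x : ℝ) (v : Fin m → ℝ),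
      pr μ (fun ω => (X ω, fun i => Y i ω)) (x, v) = pr μ X x * ∏ i, pr μ (Y i) (v i))
    (s : Finset (Fin m)) :
    ∀ (f h : ℝ → ℝ) (g : Fin m → ℝ → ℝ),
    ∑ ω, μ ω * (h (∑ i ∈ s, Y i ω) * (f (X ω) * ∏ i ∈ sᶜ, g i (Y i ω))) =
      (∑ ω, μ ω * h (∑ i ∈ s, Y i ω)) *
        ((∑ ω, μ ω * f (X ω)) * ∏ i ∈ sᶜ, ∑ ω, μ ω * g i (Y i ω)) := by
  induction s using Finset.induction_on with
  | empty =>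
    intro f h g
    have := ex_prod μ m X Y hindep f g
    simp only [Finset.sum_empty, Finset.compl_empty]
    rw [← this, ← Finset.sum_mul, hμ1, one_mul, Finset.mul_sum]
    exact Finset.sum_congr rfl fun ω _ => by ring
  | insert j s hj ih =>
    obtain ⟨B, hB⟩ : ∃ A : Finset ℝ, ∀ ω, Y j ω ∈ A := ⟨Finset.univ.image (Y j), by simp⟩
    have hc : sᶜ = insert j (insert j s)ᶜ := by
      ext i; by_cases h : i = j <;> simp [h, hj]
    have hjc : j ∉ (insert j s)ᶜ := by simp
    have step : ∀ (f h : ℝ → ℝ) (g : Fin m → ℝ → ℝ),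
        ∑ ω, μ ω * (h (∑ i ∈ insert j s, Y i ω) *
          (f (X ω) * ∏ i ∈ (insert j s)ᶜ, g i (Y i ω))) =
        (∑ y ∈ B, (∑ ω, μ ω * h (y + ∑ i ∈ s, Y i ω)) *
          (∑ ω, μ ω * (if Y j ω = y then 1 else 0))) *
        ((∑ ω, μ ω * f (X ω)) * ∏ i ∈ (insert j s)ᶜ, ∑ ω, μ ω * g i (Y i ω)) := by
      intro f h g
      simp_rw [Finset.sum_insert hj]
      rw [ex_split μ (fun ω => ∑ i ∈ s, Y i ω) (Y j) B hB h, Finset.sum_mul]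
      refine Finset.sum_congr rfl fun y _ => ?_
      have := ih f (fun t => h (y + t)) (fun i t => if i = j then (if t = y then 1 else 0) else g i t)
      rw [hc] at this
      simp only [Finset.prod_insert hjc, if_true] at this
      have hne : ∀ i ∈ (insert j s)ᶜ, i ≠ j := fun i hi h => hjc (h ▸ hi)
      have e1 : ∀ ω, ∏ i ∈ (insert j s)ᶜ, (if i = j then (if Y i ω = y then (1:ℝ) else 0) else g i (Y i ω))
          = ∏ i ∈ (insert j s)ᶜ, g i (Y i ω) := fun ω =>
        Finset.prod_congr rfl fun i hi => by simp [hne i hi]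
      have e2 : ∏ i ∈ (insert j s)ᶜ, ∑ ω, μ ω * (if i = j then (if Y i ω = y then (1:ℝ) else 0) else g i (Y i ω))
          = ∏ i ∈ (insert j s)ᶜ, ∑ ω, μ ω * g i (Y i ω) :=
        Finset.prod_congr rfl fun i hi => by simp [hne i hi]
      simp only [e1] at this
      rw [e2] at this
      rw [show ∀ a b c d : ℝ, a * b * (c * d) = a * (c * (b * d)) from fun a b c d => by ring,
        ← this]
      exact Finset.sum_congr rfl fun ω _ => by ring
    intro f h g
    rw [step f h g]
    congr 1
    have := step (fun _ => 1) h (fun _ _ => 1)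
    simp only [mul_one, Finset.prod_const_one, hμ1] at this
    exact this.symm

lemma triple_indep {Ω : Type*} [Fintype Ω] (μ : Ω → ℝ) (hμ1 : ∑ ω, μ ω = 1)
    (m : ℕ) (X : Ω → ℝ) (Y : Fin m → Ω → ℝ)
    (hindep : ∀ (x : ℝ) (v : Fin m → ℝ),
      pr μ (fun ω => (X ω, fun i => Y i ω)) (x, v) = pr μ X x * ∏ i, pr μ (Y i) (v i))
    (s : Finset (Fin m)) (j : Fin m) (hj : j ∉ s) (x y z : ℝ) :
    pr μ (fun ω => (X ω, ∑ i ∈ s, Y i ω, Y j ω)) (x, y, z)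
      = pr μ X x * pr μ (fun ω => ∑ i ∈ s, Y i ω) y * pr μ (Y j) z := by
  have := ex_block μ hμ1 m X Y hindep s (fun t => if t = x then 1 else 0)
    (fun t => if t = y then 1 else 0) (fun i t => if i = j then (if t = z then 1 else 0) else 1)
  have hc : j ∈ sᶜ := by simpa using hj
  have e1 : ∀ ω, ∏ i ∈ sᶜ, (if i = j then (if Y i ω = z then (1:ℝ) else 0) else 1)
      = if Y j ω = z then 1 else 0 := fun ω => by
    rw [Finset.prod_eq_single j] <;> simp +contextual [hj]
  have e2 : ∏ i ∈ sᶜ, ∑ ω, μ ω * (if i = j then (if Y i ω = z then (1:ℝ) else 0) else 1)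
      = ∑ ω, μ ω * if Y j ω = z then 1 else 0 := by
    rw [Finset.prod_eq_single j] <;> simp +contextual [hj, hμ1]
  simp only [e1] at this
  rw [e2] at this
  simp_rw [pr_eq_ex]
  rw [show ∀ a b c : ℝ, a * b * c = b * (a * c) from fun a b c => by ring]
  refine Eq.trans ?_ (this.trans ?_)
  · refine Finset.sum_congr rfl fun ω _ => ?_
    by_cases h1 : X ω = x <;> by_cases h2 : ∑ i ∈ s, Y i ω = y <;> by_cases h3 : Y j ω = z <;>
      simp [h1, h2, h3]
  · simp

/-- Entropy growth lemma (a simple incarnation of Tao's sumset-entropy inequality):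
if `X, Y_1, ..., Y_m` are jointly independent, `H(X) > 0`, and each
`H(X + Y_i) ≤ H(X)(1 + Cε)`, then `H(X + Y_1 + ... + Y_m) ≤ H(X)(1 + mCε)`. -/
theorem entropy_growth {Ω : Type*} [Fintype Ω] (μ : Ω → ℝ)
    (hμ0 : ∀ ω, 0 ≤ μ ω) (hμ1 : ∑ ω, μ ω = 1)
    (m : ℕ) (X : Ω → ℝ) (Y : Fin m → Ω → ℝ)
    (hindep : ∀ (x : ℝ) (v : Fin m → ℝ),
      pr μ (fun ω => (X ω, fun i => Y i ω)) (x, v) = pr μ X x * ∏ i, pr μ (Y i) (v i))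
    (hX : 0 < entropy μ X)
    (C ε : ℝ) (hC : 0 < C) (hε0 : 0 < ε) (hε : ε < 1 / 2)
    (hbound : ∀ i, entropy μ (fun ω => X ω + Y i ω) ≤ entropy μ X * (1 + C * ε)) :
    entropy μ (fun ω => X ω + ∑ i, Y i ω) ≤ entropy μ X * (1 + m * C * ε) := by
  have main : ∀ s : Finset (Fin m),
      entropy μ (fun ω => X ω + ∑ i ∈ s, Y i ω) ≤ entropy μ X * (1 + s.card * C * ε) := by
    intro s
    induction s using Finset.induction_on with
    | empty => simp
    | insert j s hj ih =>
      have h := entropy_submod μ hμ0 hμ1 X (fun ω => ∑ i ∈ s, Y i ω) (Y j)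
        (triple_indep μ hμ1 m X Y hindep s j hj)
      have e : (fun ω => X ω + ∑ i ∈ insert j s, Y i ω)
          = fun ω => X ω + ∑ i ∈ s, Y i ω + Y j ω := by
        funext ω
        rw [Finset.sum_insert hj]
        ring
      rw [e, Finset.card_insert_of_notMem hj]
      have hb := hbound j
      push_cast
      linarith
  have := main Finset.univ
  rwa [Finset.card_univ, Fintype.card_fin] at this
end

section
/- Let X, X', Z be independent G-valued finitely supported random variables with X' distributed as X, G an abelian group that is also a real vector space (e.g., G = ℝ), and p, r real numbers. Then H(pX + Z) ≤ H((p−r)X + rX' + Z) + Δ(X, X'), where Δ(X, X') = H(X − X') − (1/2)H(X) − (1/2)H(X'). -/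
open scoped Classical BigOperators

lemma pr_nonneg_aux {Ω α : Type*} [Fintype Ω] (μ : Ω → ℝ) (hμ0 : ∀ ω, 0 ≤ μ ω)
    (Y : Ω → α) (a : α) : 0 ≤ pr μ Y a := by
  unfold pr
  refine Finset.sum_nonneg fun ω _ => ?_
  split_ifs
  · exact hμ0 ω
  · exact le_rfl

lemma le_pr_self {Ω α : Type*} [Fintype Ω] (μ : Ω → ℝ) (hμ0 : ∀ ω, 0 ≤ μ ω)
    (Y : Ω → α) (ω : Ω) : μ ω ≤ pr μ Y (Y ω) := by
  unfold pr
  have h := Finset.single_le_sum (f := fun ω' => if Y ω' = Y ω then μ ω' else 0)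
    (s := Finset.univ) (fun i _ => by
      split_ifs
      · exact hμ0 i
      · exact le_rfl) (Finset.mem_univ ω)
  simpa using h

lemma pr_eq_of_iff {Ω α β : Type*} [Fintype Ω] (μ : Ω → ℝ)
    (Y : Ω → α) (Y' : Ω → β) (a : α) (b : β) (h : ∀ ω, Y ω = a ↔ Y' ω = b) :
    pr μ Y a = pr μ Y' b := by
  unfold pr
  refine Finset.sum_congr rfl fun ω _ => ?_
  simp only [h ω]

/-- Law of the unconscious statistician. -/
lemma sum_pr_mul {Ω α : Type*} [Fintype Ω] (μ : Ω → ℝ) (Y : Ω → α) (h : α → ℝ)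
    (s : Finset α) (hs : ∀ ω, Y ω ∈ s) :
    ∑ a ∈ s, pr μ Y a * h a = ∑ ω, μ ω * h (Y ω) := by
  unfold pr
  simp_rw [Finset.sum_mul]
  rw [Finset.sum_comm]
  refine Finset.sum_congr rfl fun ω _ => ?_
  rw [Finset.sum_eq_single (Y ω)]
  · simp
  · intro b _ hb
    rw [if_neg (Ne.symm hb), zero_mul]
  · intro hn
    exact absurd (hs ω) hn

lemma entropy_eq {Ω α : Type*} [Fintype Ω] (μ : Ω → ℝ) (Y : Ω → α)
    (s : Finset α) (hs : ∀ ω, Y ω ∈ s) :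
    ∑ a ∈ s, Real.negMulLog (pr μ Y a) = - ∑ ω, μ ω * Real.log (pr μ Y (Y ω)) := by
  rw [← sum_pr_mul μ Y (fun a => Real.log (pr μ Y a)) s hs, ← Finset.sum_neg_distrib]
  refine Finset.sum_congr rfl fun a _ => ?_
  rw [Real.negMulLog]; ring

lemma entropy_eq' {Ω α : Type*} [Fintype Ω] (μ : Ω → ℝ) (Y : Ω → α) :
    entropy μ Y = - ∑ ω, μ ω * Real.log (pr μ Y (Y ω)) :=
  entropy_eq μ Y _ fun ω => Finset.mem_image_of_mem _ (Finset.mem_univ ω)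

lemma entropy_ident {Ω α : Type*} [Fintype Ω] (μ : Ω → ℝ) (Y Y' : Ω → α)
    (h : ∀ a, pr μ Y a = pr μ Y' a) : entropy μ Y = entropy μ Y' := by
  rw [entropy_eq' μ Y, entropy_eq' μ Y',
    ← entropy_eq μ Y (Finset.univ.image Y ∪ Finset.univ.image Y') (by simp),
    ← entropy_eq μ Y' (Finset.univ.image Y ∪ Finset.univ.image Y') (by simp)]
  simp only [h]

lemma entropy_submod_s16 {Ω α β γ : Type*} [Fintype Ω] (μ : Ω → ℝ) (hμ0 : ∀ ω, 0 ≤ μ ω)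
    (hμ1 : ∑ ω, μ ω = 1) (S : Ω → α) (T : Ω → β) (V : Ω → γ) (f : α → γ) (g : β → γ)
    (hf : ∀ ω, V ω = f (S ω)) (hg : ∀ ω, V ω = g (T ω)) :
    entropy μ (fun ω => (S ω, T ω)) + entropy μ V ≤ entropy μ S + entropy μ T := by
  simp only [entropy_eq']
  set J : Ω → α × β := fun ω => (S ω, T ω) with hJ
  let F : α × β → ℝ := fun x =>
    if f x.1 = g x.2 then pr μ S x.1 * pr μ T x.2 / pr μ V (f x.1) else 0
  have hF0 : ∀ x, 0 ≤ F x := by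
    intro x
    dsimp only [F]
    split_ifs
    · exact div_nonneg (mul_nonneg (pr_nonneg_aux μ hμ0 _ _) (pr_nonneg_aux μ hμ0 _ _))
        (pr_nonneg_aux μ hμ0 _ _)
    · exact le_rfl
  -- pointwise bound
  have key : ∀ ω, μ ω * (Real.log (pr μ S (S ω)) + Real.log (pr μ T (T ω))
      - Real.log (pr μ J (J ω)) - Real.log (pr μ V (V ω)))
      ≤ μ ω * (F (J ω) / pr μ J (J ω)) - μ ω := by
    intro ω
    rcases (hμ0 ω).eq_or_lt with h0 | hpos
    · simp [← h0]
    have h1 := hpos.trans_le (le_pr_self μ hμ0 S ω)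
    have h2 := hpos.trans_le (le_pr_self μ hμ0 T ω)
    have h3 := hpos.trans_le (le_pr_self μ hμ0 J ω)
    have h4 := hpos.trans_le (le_pr_self μ hμ0 V ω)
    have hFe : F (J ω) = pr μ S (S ω) * pr μ T (T ω) / pr μ V (V ω) := by
      have : f (S ω) = g (T ω) := by rw [← hf, ← hg]
      simp only [F, hJ]
      rw [if_pos this, ← hf]
    have hl : Real.log (F (J ω) / pr μ J (J ω)) = Real.log (pr μ S (S ω))
        + Real.log (pr μ T (T ω)) - Real.log (pr μ J (J ω)) - Real.log (pr μ V (V ω)) := by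
      rw [hFe, Real.log_div (by positivity) h3.ne', Real.log_div (by positivity) h4.ne',
        Real.log_mul h1.ne' h2.ne']
      ring
    rw [← hl]
    have hFp : 0 < F (J ω) / pr μ J (J ω) := by rw [hFe]; positivity
    have := mul_le_mul_of_nonneg_left (Real.log_le_sub_one_of_pos hFp) hpos.le
    linarith
  have hsum := Finset.sum_le_sum fun ω (_ : ω ∈ Finset.univ) => key ω
  have hSm : ∀ ω, S ω ∈ Finset.univ.image S :=
    fun ω => Finset.mem_image_of_mem _ (Finset.mem_univ ω)
  have hTm : ∀ ω, T ω ∈ Finset.univ.image T :=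
    fun ω => Finset.mem_image_of_mem _ (Finset.mem_univ ω)
  have hle : ∑ ω, μ ω * (F (J ω) / pr μ J (J ω)) ≤ 1 := by
    rw [← sum_pr_mul μ J (fun x => F x / pr μ J x)
      (Finset.univ.image S ×ˢ Finset.univ.image T)
      (fun ω => Finset.mem_product.2 ⟨hSm ω, hTm ω⟩)]
    calc _ ≤ ∑ x ∈ Finset.univ.image S ×ˢ Finset.univ.image T, F x := by
          refine Finset.sum_le_sum fun x _ => ?_
          rcases (pr_nonneg_aux μ hμ0 J x).eq_or_lt with h0 | hp
          · rw [← h0, zero_mul]; exact hF0 x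
          · rw [mul_div_cancel₀ _ hp.ne']
      _ = ∑ s ∈ Finset.univ.image S, ∑ t ∈ Finset.univ.image T, F (s, t) :=
          Finset.sum_product _ _ _
      _ ≤ ∑ s ∈ Finset.univ.image S, pr μ S s * 1 := by
          refine Finset.sum_le_sum fun s _ => ?_
          have e : ∑ t ∈ Finset.univ.image T, F (s, t)
              = pr μ S s / pr μ V (f s) * pr μ V (f s) := by
            have e1 : pr μ V (f s) = ∑ t ∈ Finset.univ.image T,
                pr μ T t * (if f s = g t then 1 else 0) := by
              rw [sum_pr_mul μ T (fun t => if f s = g t then (1:ℝ) else 0) _ hTm]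
              unfold pr
              refine Finset.sum_congr rfl fun ω _ => ?_
              simp [hg ω, eq_comm]
            conv_rhs => arg 2; rw [e1]
            rw [Finset.mul_sum]
            refine Finset.sum_congr rfl fun t _ => ?_
            simp only [F]
            split_ifs
            · ring
            · ring
          rw [e]
          by_cases h0 : pr μ V (f s) = 0
          · rw [h0]; simpa using pr_nonneg_aux μ hμ0 S s
          · rw [div_mul_cancel₀ _ h0, mul_one]
      _ = 1 := by
          rw [sum_pr_mul μ S (fun _ => 1) _ hSm]
          simpa using hμ1
  rw [Finset.sum_sub_distrib, hμ1] at hsum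
  simp only [mul_sub, mul_add, Finset.sum_sub_distrib, Finset.sum_add_distrib] at hsum
  linarith

lemma entropy_subadd {Ω α β : Type*} [Fintype Ω] (μ : Ω → ℝ) (hμ0 : ∀ ω, 0 ≤ μ ω)
    (hμ1 : ∑ ω, μ ω = 1) (S : Ω → α) (T : Ω → β) :
    entropy μ (fun ω => (S ω, T ω)) ≤ entropy μ S + entropy μ T := by
  have h := entropy_submod_s16 μ hμ0 hμ1 S T (fun _ => ()) (fun _ => ()) (fun _ => ())
    (fun _ => rfl) (fun _ => rfl)
  have h0 : entropy μ (fun _ : Ω => ()) = 0 := by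
    rw [entropy_eq']
    have : pr μ (fun _ : Ω => ()) () = 1 := by simpa [pr] using hμ1
    simp [this]
  linarith

/-- Variation of Wu–Shamai–Verdú, Lemma 18, for real coefficients: for independent
`G`-valued random variables `X, X', Z` with `X'` a copy of `X` and reals `p, r`,
`H(pX + Z) ≤ H((p−r)X + rX' + Z) + Δ(X, X')` where
`Δ(X, X') = H(X − X') − H(X)/2 − H(X')/2`. -/
theorem entropy_real_coefficient {Ω G : Type*} [Fintype Ω] [AddCommGroup G]
    [Module ℝ G] (μ : Ω → ℝ) (hμ0 : ∀ ω, 0 ≤ μ ω) (hμ1 : ∑ ω, μ ω = 1)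
    (X X' Z : Ω → G)
    (hindep : ∀ a a' z : G,
      pr μ (fun ω => (X ω, X' ω, Z ω)) (a, a', z) = pr μ X a * pr μ X' a' * pr μ Z z)
    (hid : ∀ g : G, pr μ X g = pr μ X' g)
    (p r : ℝ) :
    entropy μ (fun ω => p • X ω + Z ω)
      ≤ entropy μ (fun ω => (p - r) • X ω + r • X' ω + Z ω) +
        (entropy μ (fun ω => X ω - X' ω)
          - (1 / 2) * entropy μ X - (1 / 2) * entropy μ X') := by
  have hX' : entropy μ X = entropy μ X' := entropy_ident μ X X' hid
  have hsub := entropy_subadd μ hμ0 hμ1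
    (fun ω => (p - r) • X ω + r • X' ω + Z ω) (fun ω => X ω - X' ω)
  have hmod := entropy_submod_s16 μ hμ0 hμ1
    (fun ω => ((p - r) • X ω + r • X' ω + Z ω, X ω - X' ω)) (fun ω => (X ω, Z ω))
    (fun ω => p • X ω + Z ω) (fun s => s.1 + r • s.2) (fun t => p • t.1 + t.2)
    (fun ω => by simp only [sub_smul, smul_sub]; abel) (fun ω => rfl)
  have hXZ : ∀ a z, pr μ (fun ω => (X ω, Z ω)) (a, z) = pr μ X a * pr μ Z z := by
    intro a z
    have hm : ∀ ω, X' ω ∈ Finset.univ.image X' :=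
      fun ω => Finset.mem_image_of_mem _ (Finset.mem_univ ω)
    have h1 : ∑ a' ∈ Finset.univ.image X', pr μ X' a' = 1 := by
      have := sum_pr_mul μ X' (fun _ => 1) _ hm
      simpa [hμ1] using this
    have h2 : ∑ a' ∈ Finset.univ.image X', pr μ (fun ω => (X ω, X' ω, Z ω)) (a, a', z)
        = pr μ (fun ω => (X ω, Z ω)) (a, z) := by
      unfold pr
      rw [Finset.sum_comm]
      refine Finset.sum_congr rfl fun ω _ => ?_
      rw [Finset.sum_eq_single (X' ω)]
      · simp
      · intro b _ hb
        rw [if_neg]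
        simp [Ne.symm hb]
      · intro hn
        exact absurd (hm ω) hn
    rw [← h2]
    simp only [hindep]
    rw [← Finset.sum_mul, ← Finset.mul_sum, h1, mul_one]
  have hJ : entropy μ (fun ω => (((p - r) • X ω + r • X' ω + Z ω, X ω - X' ω), (X ω, Z ω)))
      = entropy μ X + entropy μ X' + entropy μ Z := by
    simp only [entropy_eq', ← neg_add, ← Finset.sum_add_distrib]
    congr 1
    refine Finset.sum_congr rfl fun ω _ => ?_
    rw [pr_eq_of_iff μ _ (fun ω => (X ω, X' ω, Z ω)) _ (X ω, X' ω, Z ω), hindep]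
    · rcases (hμ0 ω).eq_or_lt with h0 | hpos
      · simp [← h0]
      have h1 := hpos.trans_le (le_pr_self μ hμ0 X ω)
      have h2 := hpos.trans_le (le_pr_self μ hμ0 X' ω)
      have h3 := hpos.trans_le (le_pr_self μ hμ0 Z ω)
      rw [Real.log_mul (by positivity) h3.ne', Real.log_mul h1.ne' h2.ne']
      ring
    · intro ω'
      simp only [Prod.mk.injEq]
      constructor
      · rintro ⟨⟨_, hu⟩, hx, hz⟩
        rw [hx] at hu
        exact ⟨hx, sub_right_injective hu, hz⟩
      · rintro ⟨hx, hx', hz⟩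
        simp [hx, hx', hz]
  have hT : entropy μ (fun ω => (X ω, Z ω)) = entropy μ X + entropy μ Z := by
    simp only [entropy_eq', ← neg_add, ← Finset.sum_add_distrib]
    congr 1
    refine Finset.sum_congr rfl fun ω _ => ?_
    rw [hXZ]
    rcases (hμ0 ω).eq_or_lt with h0 | hpos
    · simp [← h0]
    have h1 := hpos.trans_le (le_pr_self μ hμ0 X ω)
    have h3 := hpos.trans_le (le_pr_self μ hμ0 Z ω)
    rw [Real.log_mul h1.ne' h3.ne']
    ring
  rw [hJ, hT] at hmod
  linarith
end
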